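/- arXiv:cs/0408023 — 2 statements merged into one kernel-verified Lean document; each statement's English description precedes it below -/
import Mathlib

section
/- Let V be a finite type of values, n a natural number, and l, u : V → ℕ with l d ≤ u d for all d ∈ V, and suppose ∑_{d ∈ V} l d ≤ n ≤ ∑_{d ∈ V} u d. Then for every assignment a : Fin n → V there exists an assignment b : Fin n → V satisfying gcc(l,u) with hammingDist(a,b) ≤ max( ∑_{d ∈ V} overflow(a,d), ∑_{d ∈ V} underflow(a,d) ). -/
open Finset

/-- The number of variables to which `a` assigns the value `d`. -/
def valueCount {ι V : Type*} [Fintype ι] [DecidableEq V] (a : ι → V) (d : V) : ℕ :=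
  (univ.filter fun i => a i = d).card

section

variable {ι V : Type*} [Fintype ι] [DecidableEq V]

lemma sum_valueCount [Fintype V] (a : ι → V) : ∑ d, valueCount a d = Fintype.card ι :=
  (card_eq_sum_card_fiberwise fun i _ => mem_univ (a i)).symm

/-- Unless all counts are within bounds, some value `e` can give up a variable to another
value `d` so that total overflow and total underflow both decrease whenever they are positive. -/
lemma exists_transfer [Fintype V] {l u : V → ℕ} (hlu : ∀ d, l d ≤ u d)
    (hl : ∑ d, l d ≤ Fintype.card ι) (hu : Fintype.card ι ≤ ∑ d, u d) (a : ι → V)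
    (h : ¬ ∀ d, l d ≤ valueCount a d ∧ valueCount a d ≤ u d) :
    ∃ e d, e ≠ d ∧ l e < valueCount a e ∧ valueCount a d < u d ∧
      ((∀ x, valueCount a x ≤ u x) ∨ u e < valueCount a e) ∧
      ((∀ x, l x ≤ valueCount a x) ∨ valueCount a d < l d) := by
  rw [← sum_valueCount a] at hl hu
  by_cases ho : ∀ x, valueCount a x ≤ u x
  · have hn : ∃ d, valueCount a d < l d := by
      by_contra! hc
      exact h fun d => ⟨hc d, ho d⟩
    obtain ⟨d, hd⟩ := hn
    obtain ⟨e, he⟩ : ∃ e, l e < valueCount a e := by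
      by_contra! hc
      exact (sum_lt_sum (fun x _ => hc x) ⟨d, mem_univ d, hd⟩).not_ge hl
    refine ⟨e, d, ?_, he, hd.trans_le (hlu d), .inl ho, .inr hd⟩
    rintro rfl
    omega
  · push Not at ho
    obtain ⟨e, he⟩ := ho
    by_cases hn : ∀ x, l x ≤ valueCount a x
    · obtain ⟨d, hd⟩ : ∃ d, valueCount a d < u d := by
        by_contra! hc
        exact (sum_lt_sum (fun x _ => hc x) ⟨e, mem_univ e, he⟩).not_ge hu
      refine ⟨e, d, ?_, (hlu e).trans_lt he, hd, .inr he, .inl hn⟩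
      rintro rfl
      omega
    · push Not at hn
      obtain ⟨d, hd⟩ := hn
      refine ⟨e, d, ?_, (hlu e).trans_lt he, hd.trans_le (hlu d), .inr he, .inr hd⟩
      rintro rfl
      have := hlu e
      omega

variable [DecidableEq ι]

lemma valueCount_update_self (a : ι → V) (i : ι) {d : V} (h : a i ≠ d) :
    valueCount (Function.update a i d) d = valueCount a d + 1 := by
  have : (univ.filter fun j => Function.update a i d j = d) =
      insert i (univ.filter fun j => a j = d) := by
    ext j
    by_cases hj : j = i <;> simp [Function.update_apply, hj]
  rw [valueCount, this, card_insert_of_notMem (by simpa using h), valueCount]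

lemma valueCount_update_old (a : ι → V) (i : ι) {d : V} (h : a i ≠ d) :
    valueCount (Function.update a i d) (a i) + 1 = valueCount a (a i) := by
  have : (univ.filter fun j => Function.update a i d j = a i) =
      (univ.filter fun j => a j = a i).erase i := by
    ext j
    by_cases hj : j = i <;> simp [Function.update_apply, hj, h.symm]
  rw [valueCount, this, card_erase_add_one (by simp), valueCount]

lemma valueCount_update_of_ne (a : ι → V) (i : ι) {d x : V} (hd : x ≠ d) (hx : x ≠ a i) :
    valueCount (Function.update a i d) x = valueCount a x := by
  unfold valueCount
  congr 1
  ext j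
  by_cases hj : j = i <;> simp [Function.update_apply, hj, hd.symm, hx.symm]

lemma hammingDist_update_le_one (a : ι → V) (i : ι) (d : V) :
    hammingDist a (Function.update a i d) ≤ 1 := by
  rw [hammingDist, ← card_singleton i]
  refine card_le_card fun j hj => ?_
  by_contra hne
  simp_all [Function.update_apply]

lemma exists_valueCount_mem_bounds_hammingDist_le [Fintype V] {l u : V → ℕ}
    (hlu : ∀ d, l d ≤ u d) (hl : ∑ d, l d ≤ Fintype.card ι) (hu : Fintype.card ι ≤ ∑ d, u d)
    (m : ℕ) (a : ι → V) (ho : ∑ d, (valueCount a d - u d) ≤ m)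
    (hn : ∑ d, (l d - valueCount a d) ≤ m) :
    ∃ b : ι → V, (∀ d, l d ≤ valueCount b d ∧ valueCount b d ≤ u d) ∧ hammingDist a b ≤ m := by
  induction m generalizing a with
  | zero =>
    simp only [nonpos_iff_eq_zero, sum_eq_zero_iff, mem_univ, true_imp_iff,
      Nat.sub_eq_zero_iff_le] at ho hn
    exact ⟨a, fun d => ⟨hn d, ho d⟩, by simp⟩
  | succ m ih =>
    by_cases h : ∀ d, l d ≤ valueCount a d ∧ valueCount a d ≤ u d
    · exact ⟨a, h, by simp⟩
    obtain ⟨e, d, hed, hle, hud, hover, hunder⟩ := exists_transfer hlu hl hu a h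
    obtain ⟨i, hi⟩ : ∃ i, a i = e := by
      obtain ⟨i, hi⟩ := card_pos.mp ((Nat.zero_le _).trans_lt hle)
      exact ⟨i, by simpa using hi⟩
    subst hi
    set a' := Function.update a i d
    have hd' : valueCount a' d = valueCount a d + 1 := valueCount_update_self a i hed
    have he' : valueCount a' (a i) + 1 = valueCount a (a i) := valueCount_update_old a i hed
    have hx' : ∀ x, x ≠ d → x ≠ a i → valueCount a' x = valueCount a x :=
      fun x => valueCount_update_of_ne a i
    have hover_le : ∀ x, valueCount a' x - u x ≤ valueCount a x - u x := by
      intro x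
      rcases eq_or_ne x d with rfl | hxd
      · omega
      rcases eq_or_ne x (a i) with rfl | hxe
      · omega
      rw [hx' x hxd hxe]
    have hunder_le : ∀ x, l x - valueCount a' x ≤ l x - valueCount a x := by
      intro x
      rcases eq_or_ne x d with rfl | hxd
      · omega
      rcases eq_or_ne x (a i) with rfl | hxe
      · omega
      rw [hx' x hxd hxe]
    have hover' : ∑ x, (valueCount a' x - u x) ≤ m := by
      rcases hover with hz | hlt
      · refine (sum_le_sum fun x _ => hover_le x).trans ?_
        simp [Nat.sub_eq_zero_of_le (hz _)]
      · exact Nat.lt_succ_iff.mp ((sum_lt_sum (fun x _ => hover_le x)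
          ⟨a i, mem_univ _, by omega⟩).trans_le ho)
    have hunder' : ∑ x, (l x - valueCount a' x) ≤ m := by
      rcases hunder with hz | hlt
      · refine (sum_le_sum fun x _ => hunder_le x).trans ?_
        simp [Nat.sub_eq_zero_of_le (hz _)]
      · exact Nat.lt_succ_iff.mp ((sum_lt_sum (fun x _ => hunder_le x)
          ⟨d, mem_univ _, by omega⟩).trans_le hn)
    obtain ⟨b, hb, hdist⟩ := ih a' hover' hunder'
    refine ⟨b, hb, (hammingDist_triangle a a' b).trans ?_⟩
    have : hammingDist a a' ≤ 1 := hammingDist_update_le_one a i d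
    omega

end

/-- With `l d ≤ u d` and `∑ l ≤ n ≤ ∑ u`, every assignment `a` is within
Hamming distance `max(∑ overflow, ∑ underflow)` of some assignment satisfying `gcc(l,u)`. -/
theorem soft_gcc_cost_achievable
    (V : Type*) [Fintype V] [DecidableEq V] (n : ℕ) (l u : V → ℕ)
    (hlu : ∀ d, l d ≤ u d)
    (hln : ∑ d, l d ≤ n) (hnu : n ≤ ∑ d, u d)
    (a : Fin n → V) :
    ∃ b : Fin n → V,
      (∀ d, l d ≤ (univ.filter fun i => b i = d).card ∧
            (univ.filter fun i => b i = d).card ≤ u d) ∧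
      hammingDist a b ≤
        max (∑ d, ((univ.filter fun i => a i = d).card - u d))
            (∑ d, (l d - (univ.filter fun i => a i = d).card)) := by
  exact exists_valueCount_mem_bounds_hammingDist_le hlu (by simpa using hln) (by simpa using hnu)
    _ a (le_max_left _ _) (le_max_right _ _)
end

section
/- Let M be a deterministic finite automaton over a finite alphabet Σ with finite state set Q, total transition function δ, initial state q₀, and accepting set Acc. Fix n : ℕ and domains D : Fin n → Finset Σ, set χ(i,v) = 0 if v ∈ D i and 1 otherwise, and let Fwd and Bwd be the forward and backward cost functions: Fwd 0 q = 0 if q = q₀ and ∞ otherwise, Fwd (i+1) q = inf over p ∈ Q, v ∈ Σ with δ(p,v) = q of Fwd i p + χ(i,v); Bwd n q = 0 if q ∈ Acc and ∞ otherwise, Bwd i q = inf over v ∈ Σ of χ(i,v) + Bwd (i+1) (δ(q,v)). Then for every position i : Fin n and every symbol v ∈ Σ, the infimum over all length-n strings w accepted by M with w i = v of ∑_{j < n} χ(j, w j) equals the infimum over q ∈ Q of Fwd i q + χ(i,v) + Bwd (i+1) (δ(q,v)) (as an equality in ℕ∞, with the infimum of the empty set equal to ∞). -/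
open Finset

/-- The state reached by `M` after reading the first `k` symbols of the sequence `w`. -/
def DFA.stateAfter {Sym Q : Type*} (M : DFA Sym Q) (w : ℕ → Sym) (k : ℕ) : Q :=
  M.eval (List.ofFn fun j : Fin k => w j)

theorem DFA.stateAfter_zero {Sym Q : Type*} (M : DFA Sym Q) (w : ℕ → Sym) :
    M.stateAfter w 0 = M.start := by
  simp [DFA.stateAfter]

theorem DFA.stateAfter_succ {Sym Q : Type*} (M : DFA Sym Q) (w : ℕ → Sym) (k : ℕ) :
    M.stateAfter w (k + 1) = M.step (M.stateAfter w k) (w k) := by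
  unfold DFA.stateAfter
  rw [List.ofFn_succ', List.concat_eq_append, DFA.eval_append_singleton]
  simp

theorem DFA.stateAfter_congr {Sym Q : Type*} (M : DFA Sym Q) {w w' : ℕ → Sym} {k : ℕ}
    (h : ∀ j < k, w j = w' j) : M.stateAfter w k = M.stateAfter w' k := by
  unfold DFA.stateAfter
  congr 2
  funext j
  exact h j j.isLt

section Costs

variable {Sym Q : Type*} {M : DFA Sym Q} {n : ℕ} {C : ℕ → Sym → ℕ∞} {Fwd Bwd : ℕ → Q → ℕ∞}

theorem forward_cost_le (h0 : Fwd 0 M.start = 0)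
    (hS : ∀ i < n, ∀ q, Fwd (i + 1) q =
      ⨅ (p : Q) (v : Sym) (_ : M.step p v = q), Fwd i p + C i v)
    (w : ℕ → Sym) {k : ℕ} (hk : k ≤ n) :
    Fwd k (M.stateAfter w k) ≤ ∑ j ∈ Finset.range k, C j (w j) := by
  induction k with
  | zero => simp [DFA.stateAfter_zero, h0]
  | succ k ih =>
    rw [hS k hk, Finset.sum_range_succ]
    refine (iInf_le_of_le (M.stateAfter w k) <| iInf_le_of_le (w k) <|
      iInf_le _ (M.stateAfter_succ w k).symm).trans ?_
    gcongr
    exact ih (by omega)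

theorem exists_cost_le_forward [Nonempty Sym] (h0 : ∀ q ≠ M.start, Fwd 0 q = ⊤)
    (hS : ∀ i < n, ∀ q, Fwd (i + 1) q =
      ⨅ (p : Q) (v : Sym) (_ : M.step p v = q), Fwd i p + C i v)
    {k : ℕ} (hk : k ≤ n) {q : Q} (hq : Fwd k q ≠ ⊤) :
    ∃ w : ℕ → Sym, M.stateAfter w k = q ∧
      ∑ j ∈ Finset.range k, C j (w j) ≤ Fwd k q := by
  induction k generalizing q with
  | zero =>
    refine ⟨fun _ => Classical.arbitrary Sym, ?_, by simp⟩
    rw [DFA.stateAfter_zero]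
    by_contra h
    exact hq (h0 q (Ne.symm h))
  | succ k ih =>
    have hlt : Fwd (k + 1) q < Fwd (k + 1) q + 1 := (ENat.lt_add_one_iff hq).2 le_rfl
    nth_rewrite 1 [hS k hk q] at hlt
    simp only [iInf_lt_iff] at hlt
    obtain ⟨p, v, hpv, hlt⟩ := hlt
    rw [ENat.lt_add_one_iff hq] at hlt
    have hp : Fwd k p ≠ ⊤ := by
      intro h
      rw [h, top_add, top_le_iff] at hlt
      exact hq hlt
    obtain ⟨w, hw, hc⟩ := ih (by omega) hp
    have hagree : ∀ j < k, Function.update w k v j = w j := fun j hj =>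
      Function.update_of_ne hj.ne _ _
    refine ⟨Function.update w k v, ?_, ?_⟩
    · rw [DFA.stateAfter_succ, M.stateAfter_congr hagree, hw, Function.update_self, hpv]
    · rw [Finset.sum_range_succ, Function.update_self,
        Finset.sum_congr rfl fun j hj => by rw [hagree j (Finset.mem_range.1 hj)]]
      exact (add_le_add_left hc _).trans hlt

theorem backward_cost_le (hAcc : ∀ q ∈ M.accept, Bwd n q = 0)
    (hS : ∀ i < n, ∀ q, Bwd i q = ⨅ v : Sym, C i v + Bwd (i + 1) (M.step q v))
    {w : ℕ → Sym} (hw : M.stateAfter w n ∈ M.accept) {k : ℕ} (hk : k ≤ n) :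
    Bwd k (M.stateAfter w k) ≤ ∑ j ∈ Finset.Ico k n, C j (w j) := by
  induction hk using Nat.decreasingInduction with
  | self => simp [hAcc _ hw]
  | of_succ k hk ih =>
    rw [hS k hk, Finset.sum_eq_sum_Ico_succ_bot hk]
    refine (iInf_le _ (w k)).trans ?_
    rw [← DFA.stateAfter_succ]
    gcongr

theorem exists_cost_le_backward (hRej : ∀ q ∉ M.accept, Bwd n q = ⊤)
    (hS : ∀ i < n, ∀ q, Bwd i q = ⨅ v : Sym, C i v + Bwd (i + 1) (M.step q v))
    {k : ℕ} (hk : k ≤ n) (w : ℕ → Sym) (hw : Bwd k (M.stateAfter w k) ≠ ⊤) :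
    ∃ w' : ℕ → Sym, (∀ j < k, w' j = w j) ∧ M.stateAfter w' n ∈ M.accept ∧
      ∑ j ∈ Finset.Ico k n, C j (w' j) ≤ Bwd k (M.stateAfter w k) := by
  induction hk using Nat.decreasingInduction generalizing w with
  | self =>
    refine ⟨w, fun _ _ => rfl, ?_, by simp⟩
    by_contra h
    exact hw (hRej _ h)
  | of_succ k hk ih =>
    have hlt := (ENat.lt_add_one_iff hw).2 le_rfl
    nth_rewrite 1 [hS k hk] at hlt
    obtain ⟨v, hlt⟩ := iInf_lt_iff.1 hlt
    rw [ENat.lt_add_one_iff hw] at hlt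
    have hagree : ∀ j < k, Function.update w k v j = w j := fun j hj =>
      Function.update_of_ne hj.ne _ _
    have hstate : M.stateAfter (Function.update w k v) (k + 1) =
        M.step (M.stateAfter w k) v := by
      rw [DFA.stateAfter_succ, M.stateAfter_congr hagree, Function.update_self]
    have hfin : Bwd (k + 1) (M.stateAfter (Function.update w k v) (k + 1)) ≠ ⊤ := by
      intro h
      rw [← hstate, h, add_top, top_le_iff] at hlt
      exact hw hlt
    obtain ⟨w', hw', hacc, hc⟩ := ih _ hfin
    have hk' : w' k = v := by rw [hw' k k.lt_succ_self, Function.update_self]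
    refine ⟨w', fun j hj => (hw' j (by omega)).trans (hagree j hj), hacc, ?_⟩
    rw [Finset.sum_eq_sum_Ico_succ_bot hk, hk']
    rw [hstate] at hc
    exact (add_le_add_right hc _).trans hlt

end Costs

/-- Splitting a sum over `range n` at an index `i < n`. -/
theorem Finset.sum_range_eq_add_add_sum_Ico {A : Type*} [AddCommMonoid A] (f : ℕ → A)
    {i n : ℕ} (h : i < n) :
    ∑ j ∈ Finset.range n, f j =
      ∑ j ∈ Finset.range i, f j + f i + ∑ j ∈ Finset.Ico (i + 1) n, f j := by
  rw [← Finset.sum_range_succ, Finset.sum_range_add_sum_Ico f h]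

/-- Cost-based filtering for `soft_regular`: the minimum domain-violation
cost over accepted length-`n` strings `w` with `w i = v` equals the minimum over states
`q` of `Fwd i q + χ(i,v) + Bwd (i+1) (δ(q,v))`. -/
theorem soft_regular_filtering
    (Sym Q : Type*) [Fintype Sym] [DecidableEq Sym] [Fintype Q] [DecidableEq Q]
    (M : DFA Sym Q) (n : ℕ) (D : Fin n → Finset Sym)
    (χ : Fin n → Sym → ℕ∞)
    (hχ : ∀ i v, χ i v = if v ∈ D i then 0 else 1)
    (Fwd : ℕ → Q → ℕ∞)
    (hFwd0 : ∀ q, Fwd 0 q = if q = M.start then 0 else ⊤)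
    (hFwdS : ∀ (i : ℕ) (h : i < n) (q : Q), Fwd (i + 1) q =
      ⨅ (p : Q) (v : Sym) (_ : M.step p v = q), Fwd i p + χ ⟨i, h⟩ v)
    (Bwd : ℕ → Q → ℕ∞)
    (hBwdAcc : ∀ q ∈ M.accept, Bwd n q = 0)
    (hBwdRej : ∀ q ∉ M.accept, Bwd n q = ⊤)
    (hBwdS : ∀ (i : ℕ) (h : i < n) (q : Q), Bwd i q =
      ⨅ v : Sym, χ ⟨i, h⟩ v + Bwd (i + 1) (M.step q v))
    (i : Fin n) (v : Sym) :
    sInf {c : ℕ∞ | ∃ w : Fin n → Sym,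
        M.eval (List.ofFn w) ∈ M.accept ∧ w i = v ∧
        (∑ j : Fin n, χ j (w j)) = c}
    = ⨅ q : Q, Fwd i.val q + χ i v + Bwd (i.val + 1) (M.step q v) := by
  have : Nonempty Sym := ⟨v⟩
  set C : ℕ → Sym → ℕ∞ := fun j a => if h : j < n then χ ⟨j, h⟩ a else 0 with hC
  have hCχ (j : Fin n) (a : Sym) : C j a = χ j a := by simp [hC]
  have hF : ∀ i < n, ∀ q, Fwd (i + 1) q =
      ⨅ (p : Q) (v : Sym) (_ : M.step p v = q), Fwd i p + C i v := fun i h q => by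
    simp only [hFwdS i h q, hC, dif_pos h]
  have hB : ∀ i < n, ∀ q, Bwd i q = ⨅ v : Sym, C i v + Bwd (i + 1) (M.step q v) :=
    fun i h q => by simp only [hBwdS i h q, hC, dif_pos h]
  have hsum (w : ℕ → Sym) : ∑ j : Fin n, χ j (w j) = ∑ j ∈ Finset.range n, C j (w j) := by
    rw [← Fin.sum_univ_eq_sum_range (fun j => C j (w j))]
    simp only [hCχ]
  apply le_antisymm
  · refine le_iInf fun q => ?_
    by_cases htop : Fwd i q + χ i v + Bwd (i + 1) (M.step q v) = ⊤
    · rw [htop]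
      exact le_top
    simp only [ENat.add_eq_top, not_or] at htop
    obtain ⟨⟨hFq, -⟩, hBq⟩ := htop
    obtain ⟨w, hw, hcF⟩ := exists_cost_le_forward
      (fun q hq => by rw [hFwd0, if_neg hq]) hF i.isLt.le hFq
    have hagree : ∀ j < i.val, Function.update w i v j = w j := fun j hj =>
      Function.update_of_ne hj.ne _ _
    have hstate : M.stateAfter (Function.update w i v) (i + 1) = M.step q v := by
      rw [DFA.stateAfter_succ, M.stateAfter_congr hagree, hw, Function.update_self]
    rw [← hstate] at hBq ⊢
    obtain ⟨w', hw', hacc, hcB⟩ := exists_cost_le_backward hBwdRej hB i.isLt _ hBq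
    have hi : w' i = v := by rw [hw' i (Nat.lt_succ_self _), Function.update_self]
    refine sInf_le_of_le ⟨fun j => w' j, hacc, hi, rfl⟩ ?_
    rw [hsum, Finset.sum_range_eq_add_add_sum_Ico _ i.isLt, hi, hCχ]
    gcongr
    refine le_trans (le_of_eq (Finset.sum_congr rfl fun j hj => ?_)) hcF
    have hj := Finset.mem_range.1 hj
    rw [hw' j (by omega), hagree j hj]
  · refine le_sInf ?_
    rintro _ ⟨u, hacc, rfl, rfl⟩
    obtain ⟨w, rfl⟩ : ∃ w : ℕ → Sym, u = fun j : Fin n => w j :=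
      ⟨fun j => if h : j < n then u ⟨j, h⟩ else u i, by simp⟩
    rw [hsum, Finset.sum_range_eq_add_add_sum_Ico _ i.isLt, hCχ]
    refine (iInf_le _ (M.stateAfter w i)).trans ?_
    rw [← DFA.stateAfter_succ]
    gcongr
    · exact forward_cost_le (by simp [hFwd0]) hF w i.isLt.le
    · exact backward_cost_le hBwdAcc hB hacc i.isLt
end
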